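/- Let μ be a finite signed measure on ℝⁿ (n ≥ 2) with compact support and let P be a polynomial on ℝⁿ of total degree 2N. If ∫ P(x) Q(x) dμ(x) = 0 for every polynomial Q of total degree ≤ 2N with polyharmonic degree d(Q) < N, then r_0[P] = … = r_{2N−1}[P] = 0 and r_{2N}[P] is a constant function on S^{n-1}, where r_s[P] are the Laurent coefficient functions of the rest function R_P. -/

import Mathlib

open MeasureTheory Metric MvPolynomial

noncomputable section

/-- `ℝⁿ` as a Euclidean space. -/
abbrev En (n : ℕ) : Type := EuclideanSpace ℝ (Fin n)

/-- The Laplace operator `Δ = ∂²/∂x₁² + … + ∂²/∂xₙ²` acting on polynomials. -/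
def lap (n : ℕ) (P : MvPolynomial (Fin n) ℂ) : MvPolynomial (Fin n) ℂ :=
  ∑ i : Fin n, pderiv i (pderiv i P)

/-- A polynomial is harmonic if `ΔP = 0`. -/
def IsHarmonicPoly (n : ℕ) (P : MvPolynomial (Fin n) ℂ) : Prop := lap n P = 0

/-- The polyharmonic degree `d(P) = min {N : Δ^(N+1) P = 0}`. -/
def pdeg (n : ℕ) (P : MvPolynomial (Fin n) ℂ) : ℕ := sInf {N : ℕ | (lap n)^[N + 1] P = 0}

/-- Evaluation of a polynomial at a real point of `ℝⁿ`. -/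
def evalR {n : ℕ} (P : MvPolynomial (Fin n) ℂ) (x : En n) : ℂ :=
  eval (fun i => (x i : ℂ)) P

/-- Evaluation of a polynomial at `ζθ`, i.e. after substituting `ζ θ i` for `x i`. -/
def evalC {n : ℕ} (P : MvPolynomial (Fin n) ℂ) (ζ : ℂ) (θ : En n) : ℂ :=
  eval (fun i => ζ * (θ i : ℂ)) P

/-- The surface measure on the unit sphere `S^{n-1} ⊂ ℝⁿ`. -/
def sphereMeasure (n : ℕ) : Measure (sphere (0 : En n) 1) :=
  (volume : Measure (En n)).toSphere

/-- `ω_n`, the surface area of the unit sphere `S^{n-1}`. -/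
def omegaN (n : ℕ) : ℝ := ((sphereMeasure n) Set.univ).toReal

/-- The analytic continuation of `ζ ↦ r(ζθ − x)ⁿ = |ζθ − x|ⁿ` to `|ζ| > |x|`
(principal branch; for real `ζ = ρ > |x|` it equals `|ρθ − x|ⁿ`, for `θ` on the
unit sphere). -/
def rPow (n : ℕ) (ζ : ℂ) (θ x : En n) : ℂ :=
  ζ ^ n * (1 - 2 * ((inner ℝ θ x : ℝ) : ℂ) / ζ + ((‖x‖ : ℂ)) ^ 2 / ζ ^ 2) ^ ((n : ℂ) / 2)

/-- Integral of a complex-valued function against a finite signed measure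
(via the Jordan decomposition). -/
def sInt {α : Type*} [MeasurableSpace α] (μ : SignedMeasure α) (f : α → ℂ) : ℂ :=
  ∫ x, f x ∂μ.toJordanDecomposition.posPart - ∫ x, f x ∂μ.toJordanDecomposition.negPart

/-- The support of the signed measure `μ` is contained in the set `s`. -/
def SuppIn {α : Type*} [MeasurableSpace α] (μ : SignedMeasure α) (s : Set α) : Prop :=
  μ.totalVariation sᶜ = 0

/-- The multivariate Markov transform of a finite signed measure. -/
def markov {n : ℕ} (μ : SignedMeasure (En n)) (ζ : ℂ) (θ : En n) : ℂ :=
  (omegaN n : ℂ)⁻¹ * sInt μ fun x => ζ ^ (n - 1) / rPow n ζ θ x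

/-- The multivariate Markov transform of a (nonnegative) measure. -/
def markovM {n : ℕ} (μ : Measure (En n)) (ζ : ℂ) (θ : En n) : ℂ :=
  (omegaN n : ℂ)⁻¹ * ∫ x, ζ ^ (n - 1) / rPow n ζ θ x ∂μ

/-- The function of the second kind `Q_P` for a signed measure. -/
def qP {n : ℕ} (μ : SignedMeasure (En n)) (P : MvPolynomial (Fin n) ℂ) (ζ : ℂ) (θ : En n) : ℂ :=
  (omegaN n : ℂ)⁻¹ * sInt μ fun x => (evalC P ζ θ - evalR P x) * ζ ^ (n - 1) / rPow n ζ θ x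

/-- The function of the second kind `Q_P` for a (nonnegative) measure. -/
def qPM {n : ℕ} (μ : Measure (En n)) (P : MvPolynomial (Fin n) ℂ) (ζ : ℂ) (θ : En n) : ℂ :=
  (omegaN n : ℂ)⁻¹ * ∫ x, (evalC P ζ θ - evalR P x) * ζ ^ (n - 1) / rPow n ζ θ x ∂μ

/-- The rest function `R_P` for a signed measure. -/
def restP {n : ℕ} (μ : SignedMeasure (En n)) (P : MvPolynomial (Fin n) ℂ) (ζ : ℂ) (θ : En n) : ℂ :=
  (omegaN n : ℂ)⁻¹ * sInt μ fun x => evalR P x * ζ ^ (n - 1) / rPow n ζ θ x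

def lapL (n : ℕ) : MvPolynomial (Fin n) ℂ →ₗ[ℂ] MvPolynomial (Fin n) ℂ :=
  ∑ i : Fin n, (pderiv i).toLinearMap ∘ₗ (pderiv i).toLinearMap

lemma lap_eq (n : ℕ) : lap n = lapL n := by
  funext P; simp [lap, lapL]

lemma lap_iter_eq (n N : ℕ) (Q : MvPolynomial (Fin n) ℂ) : (lap n)^[N] Q = ((lapL n) ^ N) Q := by
  rw [lap_eq, Module.End.pow_apply]

def uP {n : ℕ} (θ : En n) : MvPolynomial (Fin n) ℂ := ∑ i, C (θ i : ℂ) * X i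
def vP (n : ℕ) : MvPolynomial (Fin n) ℂ := ∑ i, X i ^ 2

lemma pd_u {n : ℕ} (θ : En n) (i : Fin n) : pderiv i (uP θ) = C (θ i : ℂ) := by
  classical
  simp [uP, pderiv_X, Pi.single_apply]

lemma pd_v {n : ℕ} (i : Fin n) : pderiv i (vP n) = 2 * X i := by
  classical
  simp [vP, pderiv_X, Pi.single_apply]

lemma sum_sq {n : ℕ} (θ : En n) (h : ‖θ‖ = 1) :
    ∑ i, (C (θ i : ℂ) : MvPolynomial (Fin n) ℂ) ^ 2 = 1 := by
  have h1 : ∑ i, (θ i) ^ 2 = (1 : ℝ) := by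
    rw [← EuclideanSpace.real_norm_sq_eq, h]; norm_num
  have : (C ((∑ i, (θ i) ^ 2 : ℝ) : ℂ) : MvPolynomial (Fin n) ℂ) = 1 := by rw [h1]; simp
  rw [← this]; push_cast; simp

lemma lap_mul (n : ℕ) (f g : MvPolynomial (Fin n) ℂ) :
    lap n (f * g) = lap n f * g + 2 * ∑ i, pderiv i f * pderiv i g + f * lap n g := by
  simp only [lap, Derivation.leibniz, map_add, smul_eq_mul, Finset.mul_sum, Finset.sum_mul,
    ← Finset.sum_add_distrib]
  refine Finset.sum_congr rfl fun i _ => ?_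
  ring

lemma lap_uv {n : ℕ} (θ : En n) (h : ‖θ‖ = 1) (a b : ℕ) :
    lap n (uP θ ^ a * vP n ^ b) =
      ((a * (a - 1) : ℕ) : ℂ) • (uP θ ^ (a - 2) * vP n ^ b) +
      ((4 * a * b + 4 * b * (b - 1) + 2 * b * n : ℕ) : ℂ) • (uP θ ^ a * vP n ^ (b - 1)) := by
  have e1 : lap n (uP θ ^ a) = ((a * (a - 1) : ℕ) : MvPolynomial (Fin n) ℂ) * uP θ ^ (a - 2) := by
    have : ∀ i, pderiv i (pderiv i (uP θ ^ a)) =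
        ((a * (a - 1) : ℕ) : MvPolynomial (Fin n) ℂ) * uP θ ^ (a - 2) * C (θ i : ℂ) ^ 2 := by
      intro i
      simp only [Derivation.leibniz_pow, pd_u, Derivation.leibniz, nsmul_eq_mul, smul_eq_mul,
        pderiv_C, Nat.sub_sub, Derivation.map_natCast]
      push_cast
      ring
    rw [lap, Finset.sum_congr rfl fun i _ => this i, ← Finset.mul_sum, sum_sq θ h, mul_one]
  have e2 : lap n (vP n ^ b) =
      ((4 * b * (b - 1) + 2 * b * n : ℕ) : MvPolynomial (Fin n) ℂ) * vP n ^ (b - 1) := by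
    have : ∀ i, pderiv i (pderiv i (vP n ^ b)) =
        ((4 * b * (b - 1) : ℕ) : MvPolynomial (Fin n) ℂ) * vP n ^ (b - 2) * X i ^ 2
          + ((2 * b : ℕ) : MvPolynomial (Fin n) ℂ) * vP n ^ (b - 1) := by
      intro i
      have h2 : pderiv i (2 : MvPolynomial (Fin n) ℂ) = 0 := by
        simpa using Derivation.map_natCast (pderiv (R := ℂ) i) 2
      simp only [Derivation.leibniz_pow, pd_v, Derivation.leibniz, nsmul_eq_mul, smul_eq_mul,
        pderiv_X_self, Nat.sub_sub, Derivation.map_natCast, h2]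
      push_cast
      ring
    rw [lap, Finset.sum_congr rfl fun i _ => this i, Finset.sum_add_distrib, ← Finset.mul_sum,
      ← vP]
    rcases b with _ | _ | b <;> simp <;> ring
  have e3 : ∑ i, pderiv i (uP θ ^ a) * pderiv i (vP n ^ b) =
      ((2 * a * b : ℕ) : MvPolynomial (Fin n) ℂ) * (uP θ ^ a * vP n ^ (b - 1)) := by
    have : ∀ i, pderiv i (uP θ ^ a) * pderiv i (vP n ^ b) =
        ((2 * a * b : ℕ) : MvPolynomial (Fin n) ℂ) * (uP θ ^ (a - 1) * vP n ^ (b - 1)) *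
          (C (θ i : ℂ) * X i) := by
      intro i
      simp only [Derivation.leibniz_pow, pd_v, pd_u, nsmul_eq_mul, smul_eq_mul]
      push_cast
      ring
    rw [Finset.sum_congr rfl fun i _ => this i, ← Finset.mul_sum, ← uP]
    rcases a with _ | a <;> simp <;> ring
  rw [lap_mul, e1, e2, e3]
  simp only [MvPolynomial.smul_eq_C_mul, map_natCast]
  push_cast
  ring

lemma lapN_zero {n : ℕ} (θ : En n) (h : ‖θ‖ = 1) (N : ℕ) : ∀ a b : ℕ, a + 2 * b < 2 * N →
    (lapL n ^ N) (uP θ ^ a * vP n ^ b) = 0 := by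
  induction N with
  | zero => intro a b hab; omega
  | succ N ih =>
    intro a b hab
    rw [pow_succ, Module.End.mul_apply, ← lap_eq, lap_uv θ h, map_add, map_smul, map_smul]
    have h1 : ((a * (a - 1) : ℕ) : ℂ) • (lapL n ^ N) (uP θ ^ (a - 2) * vP n ^ b) = 0 := by
      rcases a with _ | _ | a
      · simp
      · simp
      · rw [ih _ _ (by omega), smul_zero]
    have h2 : ((4 * a * b + 4 * b * (b - 1) + 2 * b * n : ℕ) : ℂ) •
        (lapL n ^ N) (uP θ ^ a * vP n ^ (b - 1)) = 0 := by
      rcases b with _ | b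
      · simp
      · rw [ih _ _ (by omega), smul_zero]
    rw [h1, h2, add_zero]

lemma lapN_const {n : ℕ} (θ θ' : En n) (h : ‖θ‖ = 1) (h' : ‖θ'‖ = 1) (N : ℕ) :
    ∀ a b : ℕ, a + 2 * b ≤ 2 * N →
    (lapL n ^ N) (uP θ ^ a * vP n ^ b) = (lapL n ^ N) (uP θ' ^ a * vP n ^ b) := by
  induction N with
  | zero =>
    intro a b hab
    obtain rfl : a = 0 := by omega
    simp
  | succ N ih =>
    intro a b hab
    rw [pow_succ, Module.End.mul_apply, Module.End.mul_apply, ← lap_eq, lap_uv θ h, lap_uv θ' h',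
      map_add, map_smul, map_smul, map_add, map_smul, map_smul]
    have h1 : ((a * (a - 1) : ℕ) : ℂ) • (lapL n ^ N) (uP θ ^ (a - 2) * vP n ^ b) =
        ((a * (a - 1) : ℕ) : ℂ) • (lapL n ^ N) (uP θ' ^ (a - 2) * vP n ^ b) := by
      rcases a with _ | _ | a
      · simp
      · simp
      · rw [ih _ _ (by omega)]
    have h2 : ((4 * a * b + 4 * b * (b - 1) + 2 * b * n : ℕ) : ℂ) •
        (lapL n ^ N) (uP θ ^ a * vP n ^ (b - 1)) =
        ((4 * a * b + 4 * b * (b - 1) + 2 * b * n : ℕ) : ℂ) •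
        (lapL n ^ N) (uP θ' ^ a * vP n ^ (b - 1)) := by
      rcases b with _ | b
      · simp
      · rw [ih _ _ (by omega)]
    rw [h1, h2]

lemma deg_uv {n : ℕ} (θ : En n) (a b : ℕ) : (uP θ ^ a * vP n ^ b).totalDegree ≤ a + 2 * b := by
  have hu : (uP θ).totalDegree ≤ 1 := by
    refine totalDegree_finsetSum_le fun i _ => ?_
    refine (totalDegree_mul _ _).trans ?_
    simp
  have hv : (vP n).totalDegree ≤ 2 := by
    refine totalDegree_finsetSum_le fun i _ => ?_
    simp
  refine (totalDegree_mul _ _).trans ?_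
  have h1 := totalDegree_pow (uP θ) a
  have h2 := totalDegree_pow (vP n) b
  nlinarith

lemma evalR_uv {n : ℕ} (θ x : En n) (a b : ℕ) : evalR (uP θ ^ a * vP n ^ b) x =
    ((inner ℝ θ x : ℝ) : ℂ) ^ a * ((‖x‖ : ℂ) ^ 2) ^ b := by
  have : (‖x‖ : ℂ) ^ 2 = ((∑ i, x i ^ 2 : ℝ) : ℂ) := by
    rw [← EuclideanSpace.real_norm_sq_eq]; push_cast; rfl
  rw [this]
  simp [evalR, uP, vP, PiLp.inner_apply, mul_comm]

lemma pdeg_lt {n N : ℕ} (hN : 0 < N) (Q : MvPolynomial (Fin n) ℂ) (h : (lapL n ^ N) Q = 0) :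
    pdeg n Q < N := by
  have : pdeg n Q ≤ N - 1 := by
    apply Nat.sInf_le
    show (lap n)^[N - 1 + 1] Q = 0
    rw [Nat.sub_add_cancel hN, lap_iter_eq, h]
  omega

lemma poly_dvd (M : ℕ) : ∀ p : Polynomial ℂ,
    (fun t : ℂ => p.eval t) =O[nhdsWithin 0 {0}ᶜ] (fun t : ℂ => t ^ M) → Polynomial.X ^ M ∣ p := by
  induction M with
  | zero => intro p _; simp
  | succ M ih =>
    intro p hp
    have hid : Filter.Tendsto (fun t : ℂ => t) (nhdsWithin 0 {0}ᶜ) (nhds 0) :=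
      tendsto_nhdsWithin_of_tendsto_nhds Filter.tendsto_id
    have hle : (fun t : ℂ => t ^ (M+1)) =O[nhdsWithin 0 {0}ᶜ] (fun t : ℂ => t ^ M) := by
      have := (Asymptotics.isBigO_refl (fun t : ℂ => t ^ M) (nhdsWithin 0 {0}ᶜ)).mul
        (hid.isBigO_one ℂ)
      simpa [pow_succ] using this
    obtain ⟨q, rfl⟩ := ih p (hp.trans hle)
    rw [pow_succ]
    refine mul_dvd_mul_left _ ?_
    rw [Polynomial.X_dvd_iff, Polynomial.coeff_zero_eq_eval_zero]
    have hq : (fun t : ℂ => q.eval t) =O[nhdsWithin 0 {0}ᶜ] (fun t : ℂ => t) := by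
      have h2 := (Asymptotics.isBigO_refl (fun t : ℂ => (t ^ M)⁻¹) (nhdsWithin 0 {0}ᶜ)).mul hp
      refine h2.congr' ?_ ?_
      · filter_upwards [self_mem_nhdsWithin] with t ht
        have : t ≠ 0 := ht
        simp only [Polynomial.eval_mul, Polynomial.eval_pow, Polynomial.eval_X]
        field_simp
      · filter_upwards [self_mem_nhdsWithin] with t ht
        have : t ≠ 0 := ht
        field_simp
        ring
    have h0 := hq.trans_tendsto hid
    have h1 : Filter.Tendsto (fun t : ℂ => q.eval t) (nhdsWithin 0 {0}ᶜ) (nhds (q.eval 0)) :=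
      tendsto_nhdsWithin_of_tendsto_nhds q.continuous.continuousAt
    exact tendsto_nhds_unique h1 h0

def gK (n : ℕ) (w : ℂ) : ℂ := ((1 - w) ^ ((n : ℂ) / 2))⁻¹

lemma gK_taylor (n M : ℕ) : ∃ (a : ℕ → ℂ) (c δ : ℝ), 0 < δ ∧ 0 ≤ c ∧ ∀ w : ℂ, ‖w‖ < δ →
    ‖gK n w - ∑ m ∈ Finset.range M, a m * w ^ m‖ ≤ c * ‖w‖ ^ M := by
  have han : AnalyticAt ℂ (gK n) 0 := by
    unfold gK
    refine AnalyticAt.inv ?_ (by simp)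
    refine AnalyticAt.cpow (by fun_prop) (by fun_prop) (by simp)
  obtain ⟨p, hp⟩ := han
  have hO := hp.isBigO_sub_partialSum_pow M
  obtain ⟨c, hc, hO⟩ := hO.exists_nonneg
  obtain ⟨δ, hδ, h⟩ := Metric.eventually_nhds_iff.1 hO.bound
  refine ⟨p.coeff, c, δ, hδ, hc, fun w hw => ?_⟩
  have := h (y := w) (by simpa using hw)
  simpa [FormalMultilinearSeries.partialSum, mul_comm] using this

def wK {n : ℕ} (θ : En n) (t : ℂ) (x : En n) : ℂ :=
  2 * ((inner ℝ θ x : ℝ) : ℂ) * t - (‖x‖ : ℂ) ^ 2 * t ^ 2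

lemma kern_eq {n : ℕ} (hn : 2 ≤ n) (θ x : En n) (t : ℂ) (ht : t ≠ 0) (p : ℂ) :
    p * (t⁻¹) ^ (n - 1) / rPow n t⁻¹ θ x = t * (p * gK n (wK θ t x)) := by
  obtain ⟨k, rfl⟩ : ∃ k, n = k + 1 := ⟨n - 1, by omega⟩
  have : (1 - 2 * ((inner ℝ θ x : ℝ) : ℂ) / t⁻¹ + ((‖x‖ : ℂ)) ^ 2 / t⁻¹ ^ 2) = 1 - wK θ t x := by
    simp only [wK, div_inv_eq_mul, inv_pow]; ring
  rw [rPow, gK, this]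
  simp only [Nat.add_sub_cancel, div_eq_mul_inv, mul_inv, inv_pow, inv_inv]
  field_simp
  ring

lemma evalR_cont {n : ℕ} (Q : MvPolynomial (Fin n) ℂ) : Continuous (evalR Q) := by
  unfold evalR
  exact (MvPolynomial.continuous_eval Q).comp (by fun_prop)

lemma ae_ball {n : ℕ} {ν : Measure (En n)} {R : ℝ} (hν : ν (closedBall (0 : En n) R)ᶜ = 0) :
    ∀ᵐ x ∂ν, ‖x‖ ≤ R := by
  have : ∀ᵐ x ∂ν, x ∈ closedBall (0 : En n) R := by
    rw [ae_iff]; exact hν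
  filter_upwards [this] with x hx
  simpa using hx

lemma cont_bdd {n : ℕ} (f : En n → ℂ) (hf : Continuous f) (R : ℝ) :
    ∃ B : ℝ, 0 ≤ B ∧ ∀ x, ‖x‖ ≤ R → ‖f x‖ ≤ B := by
  obtain ⟨B, hB⟩ := (isCompact_closedBall (0 : En n) R).exists_bound_of_continuousOn hf.continuousOn
  exact ⟨max B 0, le_max_right _ _, fun x hx => (hB x (by simpa using hx)).trans (le_max_left _ _)⟩

lemma cont_int {n : ℕ} {ν : Measure (En n)} [IsFiniteMeasure ν] {R : ℝ}
    (hν : ν (closedBall (0 : En n) R)ᶜ = 0) (f : En n → ℂ) (hf : Continuous f) :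
    Integrable f ν := by
  obtain ⟨B, _, hB⟩ := cont_bdd f hf R
  refine Integrable.of_bound hf.aestronglyMeasurable B ?_
  filter_upwards [ae_ball hν] with x hx using hB x hx

lemma w_bound {n : ℕ} (θ : En n) (hθ : ‖θ‖ = 1) (R : ℝ) (t : ℂ) (ht : ‖t‖ ≤ 1) (x : En n)
    (hx : ‖x‖ ≤ R) : ‖wK θ t x‖ ≤ (2 * R + R ^ 2) * ‖t‖ := by
  have h0 := norm_nonneg x
  have h1 : |inner ℝ θ x| ≤ R := by
    have := abs_real_inner_le_norm θ x
    rw [hθ, one_mul] at this; linarith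
  have h2 : ‖x‖ ^ 2 ≤ R ^ 2 := by gcongr
  have h3 : ‖t‖ ^ 2 ≤ ‖t‖ := by nlinarith [norm_nonneg t]
  calc ‖wK θ t x‖ ≤ ‖2 * ((inner ℝ θ x : ℝ) : ℂ) * t‖ + ‖(‖x‖ : ℂ) ^ 2 * t ^ 2‖ := norm_sub_le _ _
    _ = 2 * |inner ℝ θ x| * ‖t‖ + ‖x‖ ^ 2 * ‖t‖ ^ 2 := by simp
    _ ≤ 2 * R * ‖t‖ + R ^ 2 * ‖t‖ := by gcongr
    _ = _ := by ring

/-- Coefficients in the expansion. -/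
def dC (a : ℕ → ℂ) (m k : ℕ) : ℂ := a m * (m.choose k : ℂ) * 2 ^ (m - k) * (-1) ^ k

lemma w_expand {n : ℕ} (a : ℕ → ℂ) (M : ℕ) (θ x : En n) (t : ℂ) :
    ∑ m ∈ Finset.range M, a m * wK θ t x ^ m =
    ∑ m ∈ Finset.range M, ∑ k ∈ Finset.range (m + 1),
      dC a m k * t ^ (m + k) * evalR (uP θ ^ (m - k) * vP n ^ k) x := by
  refine Finset.sum_congr rfl fun m _ => ?_
  have : wK θ t x = (-((‖x‖ : ℂ) ^ 2 * t ^ 2)) + 2 * ((inner ℝ θ x : ℝ) : ℂ) * t := by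
    unfold wK; ring
  rw [this, add_pow, Finset.mul_sum]
  refine Finset.sum_congr rfl fun k hk => ?_
  obtain ⟨j, rfl⟩ : ∃ j, m = k + j := ⟨m - k, by have := Finset.mem_range.1 hk; omega⟩
  rw [evalR_uv, dC, Nat.add_sub_cancel_left, neg_pow]
  ring

lemma meas_main {n : ℕ} (P : MvPolynomial (Fin n) ℂ) (θ : En n) (hθ : ‖θ‖ = 1) (R : ℝ)
    (a : ℕ → ℂ) (c δ : ℝ) (M : ℕ) (hδ : 0 < δ) (hc : 0 ≤ c)
    (ha : ∀ w : ℂ, ‖w‖ < δ →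
      ‖gK n w - ∑ m ∈ Finset.range M, a m * w ^ m‖ ≤ c * ‖w‖ ^ M)
    (ν : Measure (En n)) [IsFiniteMeasure ν] (hν : ν (closedBall (0 : En n) R)ᶜ = 0) :
    (fun t : ℂ => (∫ x, evalR P x * gK n (wK θ t x) ∂ν) -
      ∑ m ∈ Finset.range M, ∑ k ∈ Finset.range (m + 1),
      dC a m k * t ^ (m + k) * ∫ x, evalR P x * evalR (uP θ ^ (m - k) * vP n ^ k) x ∂ν)
      =O[nhdsWithin 0 {0}ᶜ] (fun t : ℂ => t ^ M) := by
  obtain ⟨B, hB0, hB⟩ := cont_bdd (evalR P) (evalR_cont P) R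
  set A := |2 * R + R ^ 2| + 1 with hA
  have hA0 : 0 < A := by positivity
  have hAb : ∀ t : ℂ, ‖t‖ ≤ 1 → ∀ x, ‖x‖ ≤ R → ‖wK θ t x‖ ≤ A * ‖t‖ := by
    intro t ht x hx
    refine (w_bound θ hθ R t ht x hx).trans ?_
    gcongr
    rw [hA]; linarith [le_abs_self (2 * R + R ^ 2)]
  refine Asymptotics.IsBigO.of_bound (B * (c * A ^ M) * ν.real Set.univ) ?_
  refine nhdsWithin_le_nhds ?_
  have : ∀ᶠ t : ℂ in nhds 0, ‖t‖ < min 1 (δ / A) := by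
    have := Metric.ball_mem_nhds (0 : ℂ) (ε := min 1 (δ / A)) (by positivity)
    filter_upwards [this] with t ht
    simpa using ht
  filter_upwards [this] with t ht
  have ht1 : ‖t‖ ≤ 1 := (ht.trans_le (min_le_left _ _)).le
  have ht2 : A * ‖t‖ < δ := by
    have := ht.trans_le (min_le_right _ _)
    rw [lt_div_iff₀ hA0] at this; linarith
  have hrem : ∀ x, ‖x‖ ≤ R → ‖evalR P x * gK n (wK θ t x) -
      evalR P x * ∑ m ∈ Finset.range M, a m * wK θ t x ^ m‖ ≤ B * (c * A ^ M) * ‖t‖ ^ M := by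
    intro x hx
    rw [← mul_sub, norm_mul]
    have h1 := hAb t ht1 x hx
    have h2 := ha _ (h1.trans_lt ht2)
    calc _ ≤ B * (c * (A * ‖t‖) ^ M) := by
          refine mul_le_mul (hB x hx) (h2.trans ?_) (norm_nonneg _) hB0
          gcongr
      _ = _ := by rw [mul_pow]; ring
  have hwc : Continuous (wK θ t) := by unfold wK; fun_prop
  have hpolyc : Continuous fun x => evalR P x * ∑ m ∈ Finset.range M, a m * wK θ t x ^ m := by
    have := evalR_cont P
    fun_prop
  have hi2 := cont_int hν _ hpolyc
  have hmeas : Measurable fun x => evalR P x * gK n (wK θ t x) := by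
    have h1 := (evalR_cont P).measurable
    have h2 := hwc.measurable
    unfold gK
    exact h1.mul (((measurable_const.sub h2).pow_const _).inv)
  have hi3 : Integrable (fun x => evalR P x * gK n (wK θ t x) -
      evalR P x * ∑ m ∈ Finset.range M, a m * wK θ t x ^ m) ν := by
    refine Integrable.of_bound (hmeas.aestronglyMeasurable.sub hi2.1) (B * (c * A ^ M) * ‖t‖ ^ M) ?_
    filter_upwards [ae_ball hν] with x hx using hrem x hx
  have hi1 : Integrable (fun x => evalR P x * gK n (wK θ t x)) ν := by
    have := hi3.add hi2
    refine this.congr (Filter.Eventually.of_forall fun x => ?_)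
    simp
  have hsum : ∑ m ∈ Finset.range M, ∑ k ∈ Finset.range (m + 1),
      dC a m k * t ^ (m + k) * ∫ x, evalR P x * evalR (uP θ ^ (m - k) * vP n ^ k) x ∂ν =
      ∫ x, evalR P x * ∑ m ∈ Finset.range M, a m * wK θ t x ^ m ∂ν := by
    have hI : ∀ m k, Integrable (fun x => dC a m k * t ^ (m + k) *
        (evalR P x * evalR (uP θ ^ (m - k) * vP n ^ k) x)) ν := fun m k =>
      (cont_int hν _ ((evalR_cont P).mul (evalR_cont _))).const_mul _
    simp_rw [w_expand, Finset.mul_sum]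
    rw [integral_finsetSum]
    · refine Finset.sum_congr rfl fun m _ => ?_
      rw [integral_finsetSum]
      · refine Finset.sum_congr rfl fun k _ => ?_
        rw [← integral_const_mul]
        congr 1; funext x; ring
      · intro k _
        exact (hI m k).congr (Filter.Eventually.of_forall fun x => by ring)
    · intro m _
      refine integrable_finsetSum _ fun k _ => ?_
      exact (hI m k).congr (Filter.Eventually.of_forall fun x => by ring)
  rw [hsum, ← integral_sub hi1 hi2]
  have := norm_integral_le_of_norm_le_const (μ := ν) (C := B * (c * A ^ M) * ‖t‖ ^ M)
    (f := fun x => evalR P x * gK n (wK θ t x) -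
      evalR P x * ∑ m ∈ Finset.range M, a m * wK θ t x ^ m)
    (by filter_upwards [ae_ball hν] with x hx using hrem x hx)
  rw [norm_pow]
  linarith

lemma supp_pos {n : ℕ} {μ : SignedMeasure (En n)} {R : ℝ}
    (hμ : SuppIn μ (closedBall (0 : En n) R)) :
    μ.toJordanDecomposition.posPart (closedBall (0 : En n) R)ᶜ = 0 ∧
    μ.toJordanDecomposition.negPart (closedBall (0 : En n) R)ᶜ = 0 := by
  unfold SuppIn SignedMeasure.totalVariation at hμ
  simpa using hμ

lemma coeff_formula (n : ℕ) (hn : 2 ≤ n) (R : ℝ)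
    (μ : SignedMeasure (En n)) (hμ : SuppIn μ (closedBall (0 : En n) R))
    (P : MvPolynomial (Fin n) ℂ) (M : ℕ) : ∃ a : ℕ → ℂ, ∀ (θ : En n), ‖θ‖ = 1 → ∀ (r : ℕ → ℂ),
    (∀ ζ : ℂ, R < ‖ζ‖ → HasSum (fun s : ℕ => r s * ζ ^ (-(s : ℤ) - 1)) (restP μ P ζ θ)) →
    ∀ s < M, r s = ∑ m ∈ Finset.range M, ∑ k ∈ Finset.range (m + 1),
      if s = m + k then (omegaN n : ℂ)⁻¹ * (dC a m k *
        sInt μ (fun x => evalR P x * evalR (uP θ ^ (m - k) * vP n ^ k) x)) else 0 := by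
  obtain ⟨a, c, δ, hδ, hc, ha⟩ := gK_taylor n M
  obtain ⟨hp, hm⟩ := supp_pos hμ
  refine ⟨a, fun θ hθ r hr => ?_⟩
  have h1 := meas_main P θ hθ R a c δ M hδ hc ha _ hp
  have h2 := meas_main P θ hθ R a c δ M hδ hc ha _ hm
  have h3 := (h1.sub h2).const_mul_left (omegaN n : ℂ)⁻¹
  -- the power series
  set f : ℂ → ℂ := fun t => ∑' s, t ^ s * r s with hf
  have hser : ∀ t : ℂ, t ≠ 0 → R < ‖t⁻¹‖ → HasSum (fun s : ℕ => t ^ s * r s)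
      ((omegaN n : ℂ)⁻¹ * sInt μ (fun x => evalR P x * gK n (wK θ t x))) := by
    intro t ht hR
    have := (hr t⁻¹ hR).mul_left t⁻¹
    have e1 : (fun s : ℕ => t⁻¹ * (r s * t⁻¹ ^ (-(s : ℤ) - 1))) = fun s : ℕ => t ^ s * r s := by
      funext s
      rw [inv_zpow', neg_sub, sub_neg_eq_add, add_comm, zpow_add₀ ht, zpow_natCast, zpow_one]
      field_simp
    have e2 : t⁻¹ * restP μ P t⁻¹ θ =
        (omegaN n : ℂ)⁻¹ * sInt μ (fun x => evalR P x * gK n (wK θ t x)) := by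
      rw [restP]
      simp only [kern_eq hn _ _ _ ht, sInt, integral_const_mul]
      field_simp
    rwa [e1, e2] at this
  have hev : ∀ᶠ t : ℂ in nhdsWithin 0 {0}ᶜ, t ≠ 0 ∧ R < ‖t⁻¹‖ := by
    have h1 : Filter.Tendsto (fun t : ℂ => ‖t⁻¹‖) (nhdsWithin 0 {0}ᶜ) Filter.atTop :=
      tendsto_norm_cobounded_atTop.comp Filter.tendsto_inv₀_nhdsNE_zero
    filter_upwards [h1.eventually_gt_atTop R, self_mem_nhdsWithin] with t h2 h3
    exact ⟨h3, h2⟩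
  have hps : HasFPowerSeriesAt f (FormalMultilinearSeries.ofScalars ℂ r) 0 := by
    rw [hasFPowerSeriesAt_iff]
    have := eventually_nhdsWithin_iff.1 hev
    filter_upwards [this] with t ht
    simp only [FormalMultilinearSeries.coeff_ofScalars, zero_add, smul_eq_mul, hf]
    by_cases h0 : t = 0
    · subst h0
      have := hasSum_single (f := fun s : ℕ => (0:ℂ) ^ s * r s) 0 (by intro b hb; simp [hb])
      rwa [← this.tsum_eq] at this
    · exact (hser t h0 (ht h0).2).summable.hasSum
  have h4 := (hps.isBigO_sub_partialSum_pow M).mono (nhdsWithin_le_nhds (s := {0}ᶜ))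
  have h4' : (fun t : ℂ => f t - ∑ s ∈ Finset.range M, r s * t ^ s)
      =O[nhdsWithin 0 {0}ᶜ] (fun t : ℂ => t ^ M) := by
    refine Asymptotics.IsBigO.trans (h4.congr_left fun t => ?_)
      (Asymptotics.isBigO_of_le _ (by simp))
    simp [FormalMultilinearSeries.partialSum, mul_comm]
  set p : Polynomial ℂ := ∑ s ∈ Finset.range M, Polynomial.monomial s (r s) with hpdef
  set q : Polynomial ℂ := ∑ m ∈ Finset.range M, ∑ k ∈ Finset.range (m + 1),
      Polynomial.monomial (m + k) ((omegaN n : ℂ)⁻¹ * (dC a m k *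
        sInt μ (fun x => evalR P x * evalR (uP θ ^ (m - k) * vP n ^ k) x))) with hqdef
  have hdvd : Polynomial.X ^ M ∣ p - q := by
    refine poly_dvd M _ ?_
    refine (h3.sub h4').congr' ?_ Filter.EventuallyEq.rfl
    filter_upwards [hev] with t ht
    have hft : f t = _ := (hser t ht.1 ht.2).tsum_eq
    rw [hft]
    have hq : q.eval t = (omegaN n : ℂ)⁻¹ *
      ((∑ m ∈ Finset.range M, ∑ k ∈ Finset.range (m + 1), dC a m k * t ^ (m + k) *
        ∫ x, evalR P x * evalR (uP θ ^ (m - k) * vP n ^ k) x ∂μ.toJordanDecomposition.posPart) -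
      (∑ m ∈ Finset.range M, ∑ k ∈ Finset.range (m + 1), dC a m k * t ^ (m + k) *
        ∫ x, evalR P x * evalR (uP θ ^ (m - k) * vP n ^ k) x
          ∂μ.toJordanDecomposition.negPart)) := by
      simp only [hqdef, Polynomial.eval_finsetSum, Polynomial.eval_monomial, sInt,
        ← Finset.sum_sub_distrib, Finset.mul_sum]
      refine Finset.sum_congr rfl fun m _ => Finset.sum_congr rfl fun k _ => ?_
      ring
    rw [Polynomial.eval_sub, hq]
    simp only [hpdef, Polynomial.eval_finsetSum, Polynomial.eval_monomial, sInt]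
    ring
  intro s hs
  have := Polynomial.X_pow_dvd_iff.1 hdvd s hs
  rw [Polynomial.coeff_sub, sub_eq_zero] at this
  simp only [hpdef, hqdef, Polynomial.finsetSum_coeff, Polynomial.coeff_monomial] at this
  simpa [hs, eq_comm (a := s)] using this

theorem laurent_proof
    (n : ℕ) (hn : 2 ≤ n) (R : ℝ)
    (μ : SignedMeasure (En n)) (hμ : SuppIn μ (closedBall (0 : En n) R))
    (P : MvPolynomial (Fin n) ℂ) (N : ℕ)
    (r : ℕ → (sphere (0 : En n) 1) → ℂ)
    (hr : ∀ θ : sphere (0 : En n) 1, ∀ ζ : ℂ, R < ‖ζ‖ →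
      HasSum (fun s : ℕ => r s θ * ζ ^ (-(s : ℤ) - 1)) (restP μ P ζ (θ : En n)))
    (horth : ∀ Q : MvPolynomial (Fin n) ℂ, Q.totalDegree ≤ 2 * N → pdeg n Q < N →
      sInt μ (fun x => evalR P x * evalR Q x) = 0) :
    (∀ s : ℕ, s < 2 * N → ∀ θ : sphere (0 : En n) 1, r s θ = 0) ∧
      (∃ c : ℂ, ∀ θ : sphere (0 : En n) 1, r (2 * N) θ = c) := by
  obtain ⟨a, ha⟩ := coeff_formula n hn R μ hμ P (2 * N + 1)
  obtain ⟨hp, hm⟩ := supp_pos hμ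
  have hnorm : ∀ θ : sphere (0 : En n) 1, ‖(θ : En n)‖ = 1 := fun θ => by simp
  have key := fun θ : sphere (0 : En n) 1 => ha θ (hnorm θ) (fun s => r s θ) (hr θ)
  constructor
  · intro s hs θ
    rw [key θ s (by omega)]
    refine Finset.sum_eq_zero fun m _ => Finset.sum_eq_zero fun k hk => ?_
    have hk := Finset.mem_range.1 hk
    split_ifs with h
    · rw [horth]
      · simp
      · exact (deg_uv _ _ _).trans (by omega)
      · exact pdeg_lt (by omega) _ (lapN_zero _ (hnorm θ) N _ _ (by omega))
    · rfl
  · have hconst : ∀ θ θ' : sphere (0 : En n) 1, r (2 * N) θ = r (2 * N) θ' := by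
      intro θ θ'
      rw [key θ _ (by omega), key θ' _ (by omega)]
      refine Finset.sum_congr rfl fun m _ => Finset.sum_congr rfl fun k hk => ?_
      have hk := Finset.mem_range.1 hk
      split_ifs with h
      · suffices hs : sInt μ (fun x => evalR P x * evalR (uP (θ : En n) ^ (m - k) * vP n ^ k) x) =
            sInt μ (fun x => evalR P x * evalR (uP (θ' : En n) ^ (m - k) * vP n ^ k) x) by rw [hs]
        rcases Nat.eq_zero_or_pos N with h0 | hN
        · obtain rfl : m = 0 := by omega
          obtain rfl : k = 0 := by omega
          simp
        have hI := horth (uP (θ : En n) ^ (m - k) * vP n ^ k - uP (θ' : En n) ^ (m - k) * vP n ^ k)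
          ((totalDegree_sub _ _).trans (max_le ((deg_uv _ _ _).trans (by omega))
            ((deg_uv _ _ _).trans (by omega))))
          (pdeg_lt hN _ (by
            rw [map_sub, lapN_const _ _ (hnorm θ) (hnorm θ') N _ _ (by omega), sub_self]))
        have hE : ∀ Q Q' : MvPolynomial (Fin n) ℂ, ∀ x : En n,
            evalR P x * evalR (Q - Q') x = evalR P x * evalR Q x - evalR P x * evalR Q' x := by
          intro Q Q' x; simp [evalR, mul_sub]
        simp only [hE, sInt] at hI
        have hc : ∀ Q : MvPolynomial (Fin n) ℂ, Continuous fun x => evalR P x * evalR Q x :=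
          fun Q => (evalR_cont P).mul (evalR_cont Q)
        rw [integral_sub (cont_int hp _ (hc _)) (cont_int hp _ (hc _)),
          integral_sub (cont_int hm _ (hc _)) (cont_int hm _ (hc _))] at hI
        simp only [sInt]
        linear_combination hI
      · rfl
    rcases isEmpty_or_nonempty (sphere (0 : En n) 1) with he | ⟨⟨θ₀⟩⟩
    · exact ⟨0, fun θ => (he.false θ).elim⟩
    · exact ⟨r (2 * N) θ₀, fun θ => hconst θ θ₀⟩

/-- If `P` has total degree `2N` and is `μ`-orthogonal to all
polynomials of degree `≤ 2N` of polyharmonic degree `< N`, then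
`r_0[P] = … = r_{2N-1}[P] = 0` and `r_{2N}[P]` is constant. -/
theorem laurent_coefficients_of_orthogonal_polynomial
    (n : ℕ) (hn : 2 ≤ n) (R : ℝ)
    (μ : SignedMeasure (En n)) (hμ : SuppIn μ (closedBall (0 : En n) R))
    (P : MvPolynomial (Fin n) ℂ) (N : ℕ) (hdeg : P.totalDegree = 2 * N)
    (r : ℕ → (sphere (0 : En n) 1) → ℂ)
    (hr : ∀ θ : sphere (0 : En n) 1, ∀ ζ : ℂ, R < ‖ζ‖ →
      HasSum (fun s : ℕ => r s θ * ζ ^ (-(s : ℤ) - 1)) (restP μ P ζ (θ : En n)))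
    (horth : ∀ Q : MvPolynomial (Fin n) ℂ, Q.totalDegree ≤ 2 * N → pdeg n Q < N →
      sInt μ (fun x => evalR P x * evalR Q x) = 0) :
    (∀ s : ℕ, s < 2 * N → ∀ θ : sphere (0 : En n) 1, r s θ = 0) ∧
      (∃ c : ℂ, ∀ θ : sphere (0 : En n) 1, r (2 * N) θ = c) := by
  exact laurent_proof n hn R μ hμ P N r hr horth
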